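/- If a 3×3 complex matrix A satisfies the matrix equation Aᵀ((tr(A)+1)I₃ − A) = adj(A) and rank(A) = 1, then A is SO(3,ℂ)-congruent to exactly one of the two matrices [[−1/2, i/2, 0],[−i/2, −1/2, 0],[0,0,0]] and [[−1/2+i, 1−i/2, 0],[1+i/2, −1/2−i, 0],[0,0,0]]. -/

import Mathlib

open Matrix Complex

/-- `SO(3,ℂ)`-congruence of 3×3 complex matrices: `B = TᵀAT` for some
`T` with `TᵀT = I₃` and `det T = 1`. -/
def SOCong (A B : Matrix (Fin 3) (Fin 3) ℂ) : Prop :=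
  ∃ T : Matrix (Fin 3) (Fin 3) ℂ, Tᵀ * T = 1 ∧ T.det = 1 ∧ B = Tᵀ * A * T

/-- The rank-one representative [[−1/2, i/2, 0],[−i/2, −1/2, 0],[0,0,0]]. -/
noncomputable def B1 : Matrix (Fin 3) (Fin 3) ℂ :=
  !![-1/2, Complex.I/2, 0;
     -Complex.I/2, -1/2, 0;
     0, 0, 0]

/-- The rank-one representative [[−1/2+i, 1−i/2, 0],[1+i/2, −1/2−i, 0],[0,0,0]]. -/
noncomputable def B2 : Matrix (Fin 3) (Fin 3) ℂ :=
  !![-1/2 + Complex.I, 1 - Complex.I/2, 0;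
     1 + Complex.I/2, -1/2 - Complex.I, 0;
     0, 0, 0]

/-- A rank-one matrix is an outer product of two nonzero vectors. -/
theorem exists_eq_vecMulVec_of_rank_eq_one {m n K : Type*} [Fintype m] [Fintype n] [Field K]
    {A : Matrix m n K} (h : A.rank = 1) :
    ∃ u v, u ≠ 0 ∧ v ≠ 0 ∧ A = vecMulVec u v := by
  obtain ⟨⟨u, _⟩, hu, hspan⟩ := finrank_eq_one_iff'.mp (A.rank_eq_finrank_span_cols.symm.trans h)
  choose v hv using fun j ↦ hspan ⟨A.col j, Submodule.subset_span ⟨j, rfl⟩⟩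
  have hA : A = vecMulVec u v := by
    ext i j
    have := congrFun (congrArg Subtype.val (hv j)) i
    simpa [vecMulVec_apply, mul_comm] using this.symm
  refine ⟨u, v, fun h0 ↦ hu (Subtype.ext h0), ?_, hA⟩
  rintro rfl
  have hA0 : A = 0 := by
    ext i j
    simp [hA, vecMulVec_apply]
  rw [hA0, rank_zero] at h
  exact zero_ne_one h

theorem cross_dot_cross_self {u v : Fin 3 → ℂ} (huu : u ⬝ᵥ u = 0) (huv : u ⬝ᵥ v = -1) :
    crossProduct u v ⬝ᵥ crossProduct u v = -1 := by
  rw [cross_dot_cross, dotProduct_comm v u, huu, huv]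
  ring

/-- The frame with rows `u`, `v` and `u × v`. -/
def crossFrame (u v : Fin 3 → ℂ) : Matrix (Fin 3) (Fin 3) ℂ :=
  of ![u, v, crossProduct u v]

theorem crossFrame_mul_transpose {u v : Fin 3 → ℂ} (huu : u ⬝ᵥ u = 0) (huv : u ⬝ᵥ v = -1) :
    crossFrame u v * (crossFrame u v)ᵀ = !![0, -1, 0; -1, v ⬝ᵥ v, 0; 0, 0, -1] := by
  have hvu : v ⬝ᵥ u = -1 := by rw [dotProduct_comm, huv]
  have h1 : crossProduct u v ⬝ᵥ u = 0 := by rw [dotProduct_comm, dot_self_cross]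
  have h2 : crossProduct u v ⬝ᵥ v = 0 := by rw [dotProduct_comm, dot_cross_self]
  ext i j
  change ![u, v, crossProduct u v] i ⬝ᵥ ![u, v, crossProduct u v] j = _
  fin_cases i <;> fin_cases j <;>
    simp [huu, huv, hvu, cross_dot_cross_self huu huv, h1, h2, dot_self_cross, dot_cross_self]

theorem det_crossFrame {u v : Fin 3 → ℂ} (huu : u ⬝ᵥ u = 0) (huv : u ⬝ᵥ v = -1) :
    (crossFrame u v).det = -1 := by
  change Matrix.det ![u, v, crossProduct u v] = -1
  rw [← triple_product_eq_det, triple_product_permutation, triple_product_permutation,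
    cross_dot_cross_self huu huv]

/-- Isotropic `u`, `u ⬝ᵥ v = -1` and the value of `v ⬝ᵥ v` determine `vecMulVec u v` up to
`SO(3,ℂ)`-congruence. -/
theorem SOCong.vecMulVec {u v u' v' : Fin 3 → ℂ}
    (huu : u ⬝ᵥ u = 0) (huv : u ⬝ᵥ v = -1) (huu' : u' ⬝ᵥ u' = 0) (huv' : u' ⬝ᵥ v' = -1)
    (hvv : v ⬝ᵥ v = v' ⬝ᵥ v') : SOCong (vecMulVec u v) (vecMulVec u' v') := by
  set M := crossFrame u v
  set N := crossFrame u' v'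
  have hdM : M.det = -1 := det_crossFrame huu huv
  have hdN : N.det = -1 := det_crossFrame huu' huv'
  have hMu : IsUnit M.det := by simp [hdM]
  have hG : N * Nᵀ = M * Mᵀ := by
    rw [crossFrame_mul_transpose huu huv, crossFrame_mul_transpose huu' huv', hvv]
  have hMT : M * (M⁻¹ * N) = N := mul_nonsing_inv_cancel_left _ _ hMu
  have hrow (i : Fin 3) : M i ᵥ* (M⁻¹ * N) = N i := by
    rw [← mul_apply_eq_vecMul, hMT]
  refine ⟨M⁻¹ * N, mul_eq_one_comm.mp ?_, ?_, ?_⟩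
  · rw [transpose_mul, ← Matrix.mul_assoc, Matrix.mul_assoc M⁻¹, hG,
      nonsing_inv_mul_cancel_left _ _ hMu, ← transpose_mul, nonsing_inv_mul _ hMu, transpose_one]
  · have := congrArg det hMT
    rw [det_mul, hdM, hdN] at this
    linear_combination -this
  · rw [mul_vecMulVec, vecMulVec_mul, mulVec_transpose]
    exact congrArg₂ Matrix.vecMulVec (hrow 0).symm (hrow 1).symm

theorem SOCong.mul_transpose_eq_zero_iff {A B : Matrix (Fin 3) (Fin 3) ℂ} (h : SOCong A B) :
    B * Bᵀ = 0 ↔ A * Aᵀ = 0 := by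
  obtain ⟨T, hT, -, rfl⟩ := h
  have hT' : T * Tᵀ = 1 := mul_eq_one_comm.mp hT
  have key : Tᵀ * A * T * (Tᵀ * A * T)ᵀ = Tᵀ * (A * Aᵀ) * T := by
    simp only [transpose_mul, transpose_transpose]
    calc Tᵀ * A * T * (Tᵀ * (Aᵀ * T)) = Tᵀ * A * (T * Tᵀ) * Aᵀ * T := by
          simp only [Matrix.mul_assoc]
      _ = _ := by rw [hT']; simp only [Matrix.mul_assoc, Matrix.mul_one]
  rw [key]
  refine ⟨fun h ↦ ?_, fun h ↦ by simp [h]⟩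
  calc A * Aᵀ = (T * Tᵀ) * (A * Aᵀ) * (T * Tᵀ) := by simp [hT']
    _ = T * (Tᵀ * (A * Aᵀ) * T) * Tᵀ := by simp only [Matrix.mul_assoc]
    _ = 0 := by simp [h]

theorem B1_eq_vecMulVec : B1 = vecMulVec ![1, I, 0] ![-1 / 2, I / 2, 0] := by
  ext i j
  fin_cases i <;> fin_cases j <;> simp [B1, vecMulVec_apply] <;> grind [I_mul_I]

theorem B2_eq_vecMulVec : B2 = vecMulVec ![1, -I, 0] ![-1 / 2 + I, 1 - I / 2, 0] := by
  ext i j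
  fin_cases i <;> fin_cases j <;> simp [B2, vecMulVec_apply] <;> grind [I_mul_I]

theorem B1_mul_transpose : B1 * B1ᵀ = 0 := by
  rw [B1_eq_vecMulVec, transpose_vecMulVec, vecMulVec_mul_vecMulVec]
  ext i j
  fin_cases i <;> fin_cases j <;> simp [vecMulVec_apply] <;> grind [I_mul_I]

theorem B2_mul_transpose_ne_zero : B2 * B2ᵀ ≠ 0 := by
  intro h
  have h00 := congrFun (congrFun h 0) 0
  simp only [B2, mul_apply, Fin.sum_univ_three, transpose_apply, of_apply, cons_val, Matrix.zero_apply]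
    at h00
  exact I_ne_zero (by linear_combination (-1 / 2) * h00 + (5 / 8) * I_mul_I)

/-- The outer products solving the matrix equation are those with `u ⬝ᵥ u = 0` and
`u ⬝ᵥ v = -1`. -/
theorem dotProduct_of_equation {u v : Fin 3 → ℂ} (hu : u ≠ 0) (hv : v ≠ 0)
    (h : (vecMulVec u v)ᵀ * (((vecMulVec u v).trace + 1) • (1 : Matrix (Fin 3) (Fin 3) ℂ) -
      vecMulVec u v) = (vecMulVec u v).adjugate) :
    u ⬝ᵥ u = 0 ∧ u ⬝ᵥ v = -1 := by
  have hadj : (vecMulVec u v).adjugate = 0 := by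
    rw [adjugate_fin_three]
    ext i j
    fin_cases i <;> fin_cases j <;> simp [vecMulVec_apply] <;> ring
  rw [hadj, transpose_vecMulVec, vecMulVec_mul, vecMulVec_eq_zero, or_iff_right hv, vecMul_sub,
    vecMul_smul, vecMul_one, vecMul_vecMulVec, trace_vecMulVec, sub_eq_zero] at h
  have ht : u ⬝ᵥ v = -1 := by
    by_contra hne
    have hne' : u ⬝ᵥ v + 1 ≠ 0 := fun h0 ↦ hne (eq_neg_of_add_eq_zero_left h0)
    have huu := congrArg (u ⬝ᵥ ·) h
    simp only [dotProduct_smul, smul_eq_mul] at huu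
    have huu0 : u ⬝ᵥ u = 0 := by linear_combination huu
    rw [huu0, zero_smul] at h
    exact (smul_ne_zero hne' hu) h
  rw [ht, neg_add_cancel, zero_smul, eq_comm, smul_eq_zero, or_iff_left hv] at h
  exact ⟨h, ht⟩

/-- Every rank-1 solution of the matrix equation
`Aᵀ((tr(A)+1)I₃ − A) = adj(A)` is `SO(3,ℂ)`-congruent to exactly one of the
two matrices `B1` and `B2`. -/
theorem statement19 (A : Matrix (Fin 3) (Fin 3) ℂ)
    (hA : Aᵀ * ((A.trace + 1) • (1 : Matrix (Fin 3) (Fin 3) ℂ) - A) = A.adjugate)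
    (hrank : A.rank = 1) :
    (SOCong A B1 ∧ ¬ SOCong A B2) ∨ (SOCong A B2 ∧ ¬ SOCong A B1) := by
  obtain ⟨u, v, hu, hv, rfl⟩ := exists_eq_vecMulVec_of_rank_eq_one hrank
  obtain ⟨huu, huv⟩ := dotProduct_of_equation hu hv hA
  have not_both : SOCong (vecMulVec u v) B1 → ¬ SOCong (vecMulVec u v) B2 := fun h1 h2 ↦
    B2_mul_transpose_ne_zero <|
      h2.mul_transpose_eq_zero_iff.mpr (h1.mul_transpose_eq_zero_iff.mp B1_mul_transpose)
  by_cases hvv : v ⬝ᵥ v = 0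
  · have h1 : SOCong (vecMulVec u v) B1 := by
      rw [B1_eq_vecMulVec]
      refine SOCong.vecMulVec huu huv ?_ ?_ (hvv.trans ?_) <;>
        simp [dotProduct, Fin.sum_univ_three] <;> grind [I_mul_I]
    exact .inl ⟨h1, not_both h1⟩
  · have h2 : SOCong (vecMulVec u v) B2 := by
      obtain ⟨c, hc⟩ := IsAlgClosed.exists_pow_nat_eq (v ⬝ᵥ v / (-2 * I)) two_pos
      have hc0 : c ≠ 0 := by
        rintro rfl
        rw [zero_pow two_ne_zero, eq_comm] at hc
        simp [hvv] at hc
      have hscale : vecMulVec u v = vecMulVec (c • u) (c⁻¹ • v) := by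
        rw [smul_vecMulVec, vecMulVec_smul, smul_smul, mul_inv_cancel₀ hc0, one_smul]
      have hvv' : v ⬝ᵥ v = c ^ 2 * (-2 * I) := by
        rw [hc, div_mul_cancel₀ _ (by simp)]
      rw [B2_eq_vecMulVec, hscale]
      refine SOCong.vecMulVec ?_ ?_ ?_ ?_ ?_
      · simp [huu]
      · simp [huv, hc0]
      · simp [dotProduct, Fin.sum_univ_three]
      · simp [dotProduct, Fin.sum_univ_three]; grind [I_mul_I]
      · simp only [dotProduct_smul, smul_dotProduct, smul_eq_mul, hvv']
        simp [dotProduct, Fin.sum_univ_three]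
        field_simp
        grind [I_mul_I]
    exact .inr ⟨h2, fun h1 ↦ not_both h1 h2⟩
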